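/- Let T > 0, let P, Q : [0,T] → ℝ be continuous, s₀ ∈ ℝ. Let L_T, L_S : ℝ×ℝ → ℝ and g : ℝ → ℝ be continuously differentiable with Lipschitz continuous derivatives, satisfying |L_T(q,a)| + |L_S(s,a)| + |g(s)| ≤ C₀(q² + s² + a²) for some constant C₀ > 0; assume moreover that for each fixed q the map (s,a) ↦ L_T(q,a) + L_S(s,a) is strictly convex and that g is strictly convex. For α ∈ L²([0,T]; ℝ) set S^α(t) = s₀ + ∫_0^t α(u) du and J(α) = ∫_0^T [P(t)(α(t) − Q(t)) + L_T(Q(t), α(t)) + L_S(S^α(t), α(t))] dt + g(S^α(T)). Then α* ∈ L²([0,T]; ℝ) is a global minimizer of J if and only if, setting S*(t) = s₀ + ∫_0^t α*(u) du and Y(t) = g'(S*(T)) + ∫_t^T ∂_s L_S(S*(u), α*(u)) du (so that Y solves the adjoint equation Y'(t) = −∂_s L_S(S*(t), α*(t)) with terminal condition Y(T) = g'(S*(T))), the coupling condition 0 = Y(t) + P(t) + ∂_α L_T(Q(t), α*(t)) + ∂_α L_S(S*(t), α*(t)) holds for almost every t ∈ [0,T]. -/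

import Mathlib

open MeasureTheory Set intervalIntegral

/-- Lebesgue measure on the time horizon `[0, T]`. -/
noncomputable abbrev timeMeasure (T : ℝ) : Measure ℝ := volume.restrict (Icc (0:ℝ) T)

/-- The storage trajectory driven by the control `a`. -/
noncomputable def storage (s₀ : ℝ) (a : ℝ → ℝ) (t : ℝ) : ℝ := s₀ + ∫ u in (0:ℝ)..t, a u

/-- The running cost of the control `a`. -/
noncomputable def runningCost (P Q : ℝ → ℝ) (s₀ : ℝ) (LT LS : ℝ × ℝ → ℝ) (a : ℝ → ℝ) (t : ℝ) : ℝ :=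
  P t * (a t - Q t) + LT (Q t, a t) + LS (storage s₀ a t, a t)

/-- The total cost of the control `a`. -/
noncomputable def totalCost (T : ℝ) (P Q : ℝ → ℝ) (s₀ : ℝ) (LT LS : ℝ × ℝ → ℝ) (g : ℝ → ℝ)
    (a : ℝ → ℝ) : ℝ :=
  (∫ t in (0:ℝ)..T, runningCost P Q s₀ LT LS a t) + g (storage s₀ a T)

/-- The adjoint state of the control `a`. -/
noncomputable def adjointState (T s₀ : ℝ) (LS : ℝ × ℝ → ℝ) (g : ℝ → ℝ) (a : ℝ → ℝ) (t : ℝ) : ℝ :=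
  deriv g (storage s₀ a T) + ∫ u in t..T, fderiv ℝ LS (storage s₀ a u, a u) (1, 0)

/-- The `L²` gradient of the total cost at the control `a`. -/
noncomputable def costGradient (T : ℝ) (P Q : ℝ → ℝ) (s₀ : ℝ) (LT LS : ℝ × ℝ → ℝ) (g : ℝ → ℝ)
    (a : ℝ → ℝ) (t : ℝ) : ℝ :=
  adjointState T s₀ LS g a t + P t + fderiv ℝ LT (Q t, a t) (0, 1)
    + fderiv ℝ LS (storage s₀ a t, a t) (0, 1)

/-- The first-order Taylor remainder of the running cost at `a` in the direction `h`. -/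
noncomputable def runningRemainder (Q : ℝ → ℝ) (s₀ : ℝ) (LT LS : ℝ × ℝ → ℝ) (a h : ℝ → ℝ)
    (t : ℝ) : ℝ :=
  (LT (Q t, a t + h t) - LT (Q t, a t) - fderiv ℝ LT (Q t, a t) (0, h t))
    + (LS (storage s₀ a t + ∫ u in (0:ℝ)..t, h u, a t + h t) - LS (storage s₀ a t, a t)
      - fderiv ℝ LS (storage s₀ a t, a t) (∫ u in (0:ℝ)..t, h u, h t))

section Calculus

variable {E : Type*} [NormedAddCommGroup E] [NormedSpace ℝ E] {f : E → ℝ}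

theorem abs_taylor_remainder_le (hf : ContDiff ℝ 1 f) {L : NNReal}
    (hL : LipschitzWith L (fderiv ℝ f)) (x v : E) :
    |f (x + v) - f x - fderiv ℝ f x v| ≤ L * ‖v‖ ^ 2 := by
  have h := Convex.norm_image_sub_le_of_norm_fderiv_le' (𝕜 := ℝ) (f := f) (φ := fderiv ℝ f x)
    (s := Metric.closedBall x ‖v‖) (C := L * ‖v‖) (x := x) (y := x + v)
    (fun z _ => hf.differentiable one_ne_zero z)
    (fun z hz => (hL.norm_sub_le z x).trans (by
      gcongr
      simpa [dist_eq_norm] using hz))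
    (convex_closedBall _ _) (by simp) (by simp)
  rw [Real.norm_eq_abs, add_sub_cancel_left] at h
  linarith

theorem ConvexOn.add_fderiv_le (hf : ConvexOn ℝ univ f) {f' : E →L[ℝ] ℝ} {x : E}
    (hx : HasFDerivAt f f' x) (v : E) : f x + f' v ≤ f (x + v) := by
  have hline : ConvexOn ℝ univ (fun t : ℝ => f (x + t • v)) := by
    refine ⟨convex_univ, fun s _ t _ a b ha hb hab => ?_⟩
    have := hf.2 (mem_univ (x + s • v)) (mem_univ (x + t • v)) ha hb hab
    convert this using 2
    have : x = a • x + b • x := by rw [← add_smul, hab, one_smul]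
    conv_lhs => rw [this]
    simp only [smul_add, smul_smul, add_smul, smul_eq_mul]
    abel
  have hd : HasDerivAt (fun t : ℝ => f (x + t • v)) (f' v) 0 := by
    have hl : HasDerivAt (fun t : ℝ => x + t • v) v 0 := by
      simpa using ((hasDerivAt_id (0:ℝ)).smul_const v).const_add x
    exact HasFDerivAt.comp_hasDerivAt (0:ℝ) (by simpa using hx) hl
  have := hline.le_slope_of_hasDerivAt (mem_univ 0) (mem_univ 1) one_pos hd
  simp [slope_def_field] at this
  linarith

variable {Ω : Type*} [MeasurableSpace Ω] {μ : Measure Ω} [IsFiniteMeasure μ] {X : Ω → E}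

theorem memLp_fderiv_apply (hf : ContDiff ℝ 1 f) {L : NNReal}
    (hL : LipschitzWith L (fderiv ℝ f)) (hX : MemLp X 2 μ) (v : E) :
    MemLp (fun t => fderiv ℝ f (X t) v) 2 μ := by
  have hm : AEStronglyMeasurable (fun t => fderiv ℝ f (X t) v) μ :=
    ((hf.continuous_fderiv one_ne_zero).clm_apply continuous_const).comp_aestronglyMeasurable
      hX.aestronglyMeasurable
  have hb : MemLp (fun t => ‖fderiv ℝ f 0‖ + L * ‖X t‖) 2 μ :=
    (memLp_const ‖fderiv ℝ f 0‖).add (hX.norm.const_mul (L : ℝ))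
  have hle : ∀ t, ‖fderiv ℝ f (X t) v‖ ≤ ‖v‖ * ‖‖fderiv ℝ f 0‖ + L * ‖X t‖‖ := fun t => by
    have h1 := hL.norm_sub_le (X t) 0
    rw [sub_zero] at h1
    have h2 : ‖fderiv ℝ f (X t)‖ ≤ ‖fderiv ℝ f 0‖ + L * ‖X t‖ := by
      have := norm_sub_norm_le (fderiv ℝ f (X t)) (fderiv ℝ f 0)
      linarith
    rw [mul_comm ‖v‖]
    exact ((fderiv ℝ f (X t)).le_opNorm v).trans
      (mul_le_mul_of_nonneg_right (h2.trans (Real.le_norm_self _)) (norm_nonneg v))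
  exact hb.of_le_mul hm (Filter.Eventually.of_forall hle)

theorem integrable_comp_of_lipschitz_fderiv (hf : ContDiff ℝ 1 f) {L : NNReal}
    (hL : LipschitzWith L (fderiv ℝ f)) (hX : MemLp X 2 μ) :
    Integrable (fun t => f (X t)) μ := by
  have hm : AEStronglyMeasurable (fun t => f (X t)) μ :=
    hf.continuous.comp_aestronglyMeasurable hX.aestronglyMeasurable
  have hb : Integrable (fun t => |f 0| + ‖fderiv ℝ f 0‖ * ‖X t‖ + L * ‖X t‖ ^ 2) μ :=
    ((integrable_const _).add ((hX.integrable (by norm_num)).norm.const_mul _)).add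
      ((hX.integrable_norm_pow two_ne_zero).const_mul _)
  refine hb.mono' hm (Filter.Eventually.of_forall fun t => ?_)
  have h1 := abs_taylor_remainder_le hf hL 0 (X t)
  rw [zero_add] at h1
  have h2 := (fderiv ℝ f 0).le_opNorm (X t)
  rw [Real.norm_eq_abs] at h2 ⊢
  have h3 : f (X t) = (f (X t) - f 0 - fderiv ℝ f 0 (X t)) + f 0 + fderiv ℝ f 0 (X t) := by ring
  rw [h3]
  refine (abs_add_three _ _ _).trans ?_
  linarith

end Calculus

theorem clm_prod_apply (φ : ℝ × ℝ →L[ℝ] ℝ) (x y : ℝ) : φ (x, y) = x * φ (1, 0) + y * φ (0, 1) := by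
  have : (x, y) = x • ((1, 0) : ℝ × ℝ) + y • ((0, 1) : ℝ × ℝ) := by simp
  rw [this, map_add, map_smul, map_smul, smul_eq_mul, smul_eq_mul]

theorem integral_primitive_mul_eq {T : ℝ} {h f : ℝ → ℝ} (hh : IntervalIntegrable h volume 0 T)
    (hf : IntervalIntegrable f volume 0 T) :
    ∫ t in (0:ℝ)..T, (∫ u in (0:ℝ)..t, h u) * f t = ∫ t in (0:ℝ)..T, h t * ∫ u in t..T, f u := by
  have key := AbsolutelyContinuousOnInterval.integral_mul_deriv_eq_deriv_mul
    (hh.absolutelyContinuousOnInterval_intervalIntegral (c := 0) (by simp))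
    (hf.absolutelyContinuousOnInterval_intervalIntegral (c := T) (by simp))
  have e1 : ∫ t in (0:ℝ)..T, (∫ u in (0:ℝ)..t, h u) * deriv (fun x => ∫ v in T..x, f v) t
      = ∫ t in (0:ℝ)..T, (∫ u in (0:ℝ)..t, h u) * f t := by
    apply intervalIntegral.integral_congr_ae
    filter_upwards [hf.ae_hasDerivAt_integral] with t ht hmem
    rw [(ht (uIoc_subset_uIcc hmem) T (by simp)).deriv]
  have e2 : ∫ t in (0:ℝ)..T, deriv (fun x => ∫ v in (0:ℝ)..x, h v) t * (∫ u in T..t, f u)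
      = - ∫ t in (0:ℝ)..T, h t * ∫ u in t..T, f u := by
    rw [← intervalIntegral.integral_neg]
    apply intervalIntegral.integral_congr_ae
    filter_upwards [hh.ae_hasDerivAt_integral] with t ht hmem
    rw [(ht (uIoc_subset_uIcc hmem) 0 (by simp)).deriv, intervalIntegral.integral_symm t T]
    ring
  rw [e1, e2] at key
  simpa using key

section Interval

variable {T : ℝ}

theorem memLp_of_continuousOn_Icc {f : ℝ → ℝ} (hf : ContinuousOn f (Icc 0 T)) :
    MemLp f 2 (timeMeasure T) := by
  obtain ⟨C, hC⟩ := isCompact_Icc.exists_bound_of_continuousOn hf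
  exact MemLp.of_bound (hf.aestronglyMeasurable measurableSet_Icc) C
    ((ae_restrict_iff' measurableSet_Icc).2 (Filter.Eventually.of_forall hC))

theorem intervalIntegral_eq_integral_Icc (hT : 0 < T) (f : ℝ → ℝ) :
    ∫ t in (0:ℝ)..T, f t = ∫ t, f t ∂(timeMeasure T) := by
  rw [intervalIntegral.integral_of_le hT.le, integral_Icc_eq_integral_Ioc]

theorem intervalIntegrable_of_integrable_Icc (hT : 0 < T) {f : ℝ → ℝ}
    (hf : Integrable f (timeMeasure T)) : IntervalIntegrable f volume 0 T :=
  IntegrableOn.intervalIntegrable (by rw [uIcc_of_le hT.le]; exact hf)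

theorem intervalIntegrable_of_memLp_Icc (hT : 0 < T) {f : ℝ → ℝ}
    (hf : MemLp f 2 (timeMeasure T)) : IntervalIntegrable f volume 0 T :=
  intervalIntegrable_of_integrable_Icc hT (hf.integrable (by norm_num))

theorem memLp_primitive (hT : 0 < T) {h : ℝ → ℝ}
    (hh : MemLp h 2 (timeMeasure T)) :
    MemLp (fun t => ∫ u in (0:ℝ)..t, h u) 2 (timeMeasure T) := by
  apply memLp_of_continuousOn_Icc
  have := continuousOn_primitive_interval' (intervalIntegrable_of_memLp_Icc hT hh) left_mem_uIcc
  rwa [uIcc_of_le hT.le] at this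

theorem memLp_storage (hT : 0 < T) (s₀ : ℝ) {a : ℝ → ℝ}
    (ha : MemLp a 2 (timeMeasure T)) :
    MemLp (storage s₀ a) 2 (timeMeasure T) :=
  (memLp_const s₀).add (memLp_primitive hT ha)

theorem storage_add (hT : 0 < T) (s₀ : ℝ) {a h : ℝ → ℝ}
    (ha : MemLp a 2 (timeMeasure T))
    (hh : MemLp h 2 (timeMeasure T)) {t : ℝ} (ht : t ∈ Icc 0 T) :
    storage s₀ (fun u => a u + h u) t = storage s₀ a t + ∫ u in (0:ℝ)..t, h u := by
  have hsub : uIcc 0 t ⊆ uIcc 0 T := by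
    rw [uIcc_of_le ht.1, uIcc_of_le hT.le]
    exact Icc_subset_Icc_right ht.2
  simp only [storage]
  rw [intervalIntegral.integral_add ((intervalIntegrable_of_memLp_Icc hT ha).mono_set hsub)
    ((intervalIntegrable_of_memLp_Icc hT hh).mono_set hsub)]
  ring

theorem storage_congr (s₀ : ℝ) {a b : ℝ → ℝ}
    (hab : a =ᵐ[timeMeasure T] b) {t : ℝ} (ht : t ∈ Icc 0 T) :
    storage s₀ a t = storage s₀ b t := by
  simp only [storage]
  congr 1
  apply intervalIntegral.integral_congr_ae
  filter_upwards [(ae_restrict_iff' measurableSet_Icc).1 hab] with u hu hmem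
  rw [uIoc_of_le ht.1] at hmem
  exact hu ⟨hmem.1.le, hmem.2.trans ht.2⟩

theorem totalCost_congr (hT : 0 < T) (P Q : ℝ → ℝ) (s₀ : ℝ) (LT LS : ℝ × ℝ → ℝ) (g : ℝ → ℝ)
    {a b : ℝ → ℝ} (hab : a =ᵐ[timeMeasure T] b) :
    totalCost T P Q s₀ LT LS g a = totalCost T P Q s₀ LT LS g b := by
  simp only [totalCost, intervalIntegral_eq_integral_Icc hT]
  rw [storage_congr s₀ hab (right_mem_Icc.2 hT.le)]
  congr 1
  apply MeasureTheory.integral_congr_ae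
  filter_upwards [hab, ae_restrict_mem measurableSet_Icc] with t ht hmem
  simp only [runningCost, ht, storage_congr s₀ hab hmem]

end Interval

section Cost

variable {T : ℝ} {P Q : ℝ → ℝ} {s₀ : ℝ} {LT LS : ℝ × ℝ → ℝ} {g : ℝ → ℝ} {KT KS : NNReal}
  {a h : ℝ → ℝ}

theorem integrable_runningCost (hT : 0 < T) (hP : ContinuousOn P (Icc 0 T))
    (hQ : ContinuousOn Q (Icc 0 T)) (hLT : ContDiff ℝ 1 LT) (hLS : ContDiff ℝ 1 LS)
    (hKT : LipschitzWith KT (fderiv ℝ LT)) (hKS : LipschitzWith KS (fderiv ℝ LS))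
    (ha : MemLp a 2 (timeMeasure T)) :
    Integrable (runningCost P Q s₀ LT LS a) (timeMeasure T) :=
  (((memLp_of_continuousOn_Icc hP).integrable_mul (ha.sub (memLp_of_continuousOn_Icc hQ))).add
    (integrable_comp_of_lipschitz_fderiv hLT hKT
      (MemLp.of_fst_snd ⟨memLp_of_continuousOn_Icc hQ, ha⟩))).add
    (integrable_comp_of_lipschitz_fderiv hLS hKS (MemLp.of_fst_snd ⟨memLp_storage hT s₀ ha, ha⟩))

theorem memLp_adjointState (hT : 0 < T) (hLS : ContDiff ℝ 1 LS)
    (hKS : LipschitzWith KS (fderiv ℝ LS))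
    (ha : MemLp a 2 (timeMeasure T)) :
    MemLp (adjointState T s₀ LS g a) 2 (timeMeasure T) := by
  have hfs : MemLp (fun t => fderiv ℝ LS (storage s₀ a t, a t) (1, 0)) 2
      (timeMeasure T) :=
    memLp_fderiv_apply hLS hKS (MemLp.of_fst_snd ⟨memLp_storage hT s₀ ha, ha⟩) _
  refine memLp_of_continuousOn_Icc (continuousOn_const.add ?_)
  have := continuousOn_primitive_interval_left (a := 0) (b := T) (μ := volume)
    (f := fun t => fderiv ℝ LS (storage s₀ a t, a t) (1, 0))
    (by rw [uIcc_of_le hT.le]; exact hfs.integrable (by norm_num))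
  rwa [uIcc_of_le hT.le] at this

theorem memLp_costGradient (hT : 0 < T) (hP : ContinuousOn P (Icc 0 T))
    (hQ : ContinuousOn Q (Icc 0 T)) (hLT : ContDiff ℝ 1 LT) (hLS : ContDiff ℝ 1 LS)
    (hKT : LipschitzWith KT (fderiv ℝ LT)) (hKS : LipschitzWith KS (fderiv ℝ LS))
    (ha : MemLp a 2 (timeMeasure T)) :
    MemLp (costGradient T P Q s₀ LT LS g a) 2 (timeMeasure T) :=
  (((memLp_adjointState hT hLS hKS ha).add (memLp_of_continuousOn_Icc hP)).add
    (memLp_fderiv_apply hLT hKT (MemLp.of_fst_snd ⟨memLp_of_continuousOn_Icc hQ, ha⟩) _)).add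
    (memLp_fderiv_apply hLS hKS (MemLp.of_fst_snd ⟨memLp_storage hT s₀ ha, ha⟩) _)

/-- First-order expansion of the total cost, the linear term being expressed through the adjoint
state by an integration by parts. -/
theorem totalCost_add_eq (hT : 0 < T) (hP : ContinuousOn P (Icc 0 T))
    (hQ : ContinuousOn Q (Icc 0 T)) (hLT : ContDiff ℝ 1 LT) (hLS : ContDiff ℝ 1 LS)
    (hKT : LipschitzWith KT (fderiv ℝ LT)) (hKS : LipschitzWith KS (fderiv ℝ LS))
    (ha : MemLp a 2 (timeMeasure T))
    (hh : MemLp h 2 (timeMeasure T)) :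
    Integrable (runningRemainder Q s₀ LT LS a h) (timeMeasure T) ∧
    totalCost T P Q s₀ LT LS g (fun t => a t + h t) = totalCost T P Q s₀ LT LS g a
      + ∫ t, costGradient T P Q s₀ LT LS g a t * h t ∂(timeMeasure T)
      + ∫ t, runningRemainder Q s₀ LT LS a h t ∂(timeMeasure T)
      + (g (storage s₀ a T + ∫ u in (0:ℝ)..T, h u) - g (storage s₀ a T)
        - deriv g (storage s₀ a T) * ∫ u in (0:ℝ)..T, h u) := by
  set fs : ℝ → ℝ := fun t => fderiv ℝ LS (storage s₀ a t, a t) (1, 0) with hfs_def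
  set H : ℝ → ℝ := fun t => ∫ u in (0:ℝ)..t, h u with hH
  have hXS := MemLp.of_fst_snd (f := fun t => (storage s₀ a t, a t)) ⟨memLp_storage hT s₀ ha, ha⟩
  have hfs : MemLp fs 2 (timeMeasure T) := memLp_fderiv_apply hLS hKS hXS _
  have hah : MemLp (fun t => a t + h t) 2 (timeMeasure T) := ha.add hh
  have hw := memLp_costGradient (s₀ := s₀) (g := g) hT hP hQ hLT hLS hKT hKS ha
  have hHm : MemLp H 2 (timeMeasure T) := memLp_primitive hT hh
  have hY := memLp_adjointState (s₀ := s₀) (g := g) hT hLS hKS ha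
  have i1 := integrable_runningCost (s₀ := s₀) hT hP hQ hLT hLS hKT hKS hah
  have i0 := integrable_runningCost (s₀ := s₀) hT hP hQ hLT hLS hKT hKS ha
  have iw : Integrable (fun t => costGradient T P Q s₀ LT LS g a t * h t) (timeMeasure T) :=
    hw.integrable_mul hh
  have iY : Integrable (fun t => adjointState T s₀ LS g a t * h t) (timeMeasure T) :=
    hY.integrable_mul hh
  have iH : Integrable (fun t => H t * fs t) (timeMeasure T) := hHm.integrable_mul hfs
  have hpt : ∀ᵐ t ∂(timeMeasure T), runningRemainder Q s₀ LT LS a h t =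
      runningCost P Q s₀ LT LS (fun t => a t + h t) t - runningCost P Q s₀ LT LS a t
        - costGradient T P Q s₀ LT LS g a t * h t + adjointState T s₀ LS g a t * h t
        - H t * fs t := by
    filter_upwards [ae_restrict_mem measurableSet_Icc] with t ht
    simp only [runningRemainder, runningCost, costGradient, storage_add hT s₀ ha hh ht]
    rw [clm_prod_apply _ 0 (h t), clm_prod_apply _ (∫ u in (0:ℝ)..t, h u) (h t)]
    simp only [hfs_def, hH]
    ring
  have i10 : Integrable (fun t => runningCost P Q s₀ LT LS (fun t => a t + h t) t
      - runningCost P Q s₀ LT LS a t) (timeMeasure T) := i1.sub i0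
  have i10w : Integrable (fun t => runningCost P Q s₀ LT LS (fun t => a t + h t) t
      - runningCost P Q s₀ LT LS a t - costGradient T P Q s₀ LT LS g a t * h t)
      (timeMeasure T) := i10.sub iw
  have i10wY : Integrable (fun t => runningCost P Q s₀ LT LS (fun t => a t + h t) t
      - runningCost P Q s₀ LT LS a t - costGradient T P Q s₀ LT LS g a t * h t
      + adjointState T s₀ LS g a t * h t) (timeMeasure T) := i10w.add iY
  refine ⟨(i10wY.sub iH).congr (hpt.mono fun t ht => ht.symm), ?_⟩
  have hrem := MeasureTheory.integral_congr_ae hpt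
  rw [integral_sub i10wY iH, integral_add i10w iY, integral_sub i10 iw, integral_sub i1 i0] at hrem
  have hparts := integral_primitive_mul_eq (intervalIntegrable_of_memLp_Icc hT hh)
    (intervalIntegrable_of_memLp_Icc hT hfs)
  have hYint : ∫ t, adjointState T s₀ LS g a t * h t ∂(timeMeasure T) =
      deriv g (storage s₀ a T) * H T + ∫ t, H t * fs t ∂(timeMeasure T) := by
    rw [← intervalIntegral_eq_integral_Icc hT (fun t => H t * fs t), hparts,
      intervalIntegral_eq_integral_Icc hT, hH]
    simp only
    rw [intervalIntegral_eq_integral_Icc hT h, ← MeasureTheory.integral_const_mul, ← integral_add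
      ((hh.integrable (by norm_num)).const_mul _)]
    · refine MeasureTheory.integral_congr_ae (Filter.Eventually.of_forall fun t => ?_)
      simp only [adjointState, hfs_def]
      ring
    · refine (iY.sub ((hh.integrable (by norm_num)).const_mul
        (deriv g (storage s₀ a T)))).congr (Filter.Eventually.of_forall fun t => ?_)
      simp only [adjointState, hfs_def, Pi.sub_apply]
      ring
  simp only [totalCost, intervalIntegral_eq_integral_Icc hT (runningCost _ _ _ _ _ _),
    storage_add hT s₀ ha hh (right_mem_Icc.2 hT.le)]
  simp only [hH] at hYint
  linarith

theorem runningRemainder_nonneg (hLT : ContDiff ℝ 1 LT) (hLS : ContDiff ℝ 1 LS)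
    (hconv : ∀ q : ℝ, ConvexOn ℝ univ (fun x : ℝ × ℝ => LT (q, x.2) + LS (x.1, x.2))) (t : ℝ) :
    0 ≤ runningRemainder Q s₀ LT LS a h t := by
  have h1 : HasFDerivAt (fun x : ℝ × ℝ => LT (Q t, x.2))
      ((fderiv ℝ LT (Q t, a t)).comp ((0 : ℝ × ℝ →L[ℝ] ℝ).prod (ContinuousLinearMap.snd ℝ ℝ ℝ)))
      (storage s₀ a t, a t) :=
    HasFDerivAt.comp (g := LT) (f := fun x : ℝ × ℝ => (Q t, x.2)) (storage s₀ a t, a t)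
      (hLT.differentiable one_ne_zero _).hasFDerivAt
      ((hasFDerivAt_const _ _).prodMk hasFDerivAt_snd)
  have h2 : HasFDerivAt (fun x : ℝ × ℝ => LS (x.1, x.2)) (fderiv ℝ LS (storage s₀ a t, a t))
      (storage s₀ a t, a t) := (hLS.differentiable one_ne_zero _).hasFDerivAt
  have := (hconv (Q t)).add_fderiv_le (h1.add h2) (∫ u in (0:ℝ)..t, h u, h t)
  simp at this
  simp only [runningRemainder]
  linarith

theorem runningRemainder_le (hLT : ContDiff ℝ 1 LT) (hLS : ContDiff ℝ 1 LS)
    (hKT : LipschitzWith KT (fderiv ℝ LT)) (hKS : LipschitzWith KS (fderiv ℝ LS)) (t : ℝ) :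
    runningRemainder Q s₀ LT LS a h t ≤
      (KT + KS) * (h t ^ 2 + (∫ u in (0:ℝ)..t, h u) ^ 2) := by
  have hn : ∀ x y : ℝ, ‖(x, y)‖ ^ 2 ≤ y ^ 2 + x ^ 2 := fun x y => by
    rw [Prod.norm_mk]
    rcases max_cases ‖x‖ ‖y‖ with ⟨e, _⟩ | ⟨e, _⟩ <;> rw [e, Real.norm_eq_abs, sq_abs] <;> nlinarith
  have h1 := (le_abs_self _).trans (abs_taylor_remainder_le hLT hKT (Q t, a t) (0, h t))
  have h2 := (le_abs_self _).trans
    (abs_taylor_remainder_le hLS hKS (storage s₀ a t, a t) (∫ u in (0:ℝ)..t, h u, h t))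
  simp only [Prod.mk_add_mk, add_zero] at h1 h2
  have h3 := mul_le_mul_of_nonneg_left (hn 0 (h t)) KT.2
  have h4 := mul_le_mul_of_nonneg_left (hn (∫ u in (0:ℝ)..t, h u) (h t)) KS.2
  have h5 := mul_nonneg KT.2 (sq_nonneg (∫ u in (0:ℝ)..t, h u))
  simp only [runningRemainder]
  simp only [NNReal.val_eq_coe] at h3 h4 h5
  linarith

end Cost

theorem stmt_17 (T : ℝ) (hT : 0 < T) (P Q : ℝ → ℝ)
    (hP : ContinuousOn P (Icc 0 T)) (hQ : ContinuousOn Q (Icc 0 T)) (s₀ : ℝ)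
    (LT LS : ℝ × ℝ → ℝ) (g : ℝ → ℝ)
    (hLT : ContDiff ℝ 1 LT) (hLS : ContDiff ℝ 1 LS) (hg : ContDiff ℝ 1 g)
    (hLTlip : ∃ L : NNReal, LipschitzWith L (fderiv ℝ LT))
    (hLSlip : ∃ L : NNReal, LipschitzWith L (fderiv ℝ LS))
    (hglip : ∃ L : NNReal, LipschitzWith L (deriv g))
    (C₀ : ℝ) (hC₀ : 0 < C₀)
    (hgrowth : ∀ q s a : ℝ,
      |LT (q, a)| + |LS (s, a)| + |g s| ≤ C₀ * (q ^ 2 + s ^ 2 + a ^ 2))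
    (hconv : ∀ q : ℝ, StrictConvexOn ℝ Set.univ
      (fun x : ℝ × ℝ => LT (q, x.2) + LS (x.1, x.2)))
    (hgconv : StrictConvexOn ℝ Set.univ g)
    (S : Lp ℝ 2 (volume.restrict (Icc (0:ℝ) T)) → ℝ → ℝ)
    (hS : ∀ α t, S α t = s₀ + ∫ u in (0:ℝ)..t, α u)
    (J : Lp ℝ 2 (volume.restrict (Icc (0:ℝ) T)) → ℝ)
    (hJ : ∀ α, J α =
      (∫ t in (0:ℝ)..T,
        (P t * (α t - Q t) + LT (Q t, α t) + LS (S α t, α t)))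
      + g (S α T))
    (αs : Lp ℝ 2 (volume.restrict (Icc (0:ℝ) T)))
    (Y : ℝ → ℝ)
    (hY : ∀ t, Y t = deriv g (S αs T)
      + ∫ u in t..T, deriv (fun x => LS (x, αs u)) (S αs u)) :
    (∀ β, J αs ≤ J β) ↔
      (∀ᵐ t ∂(volume.restrict (Icc (0:ℝ) T)),
        0 = Y t + P t + deriv (fun x => LT (Q t, x)) (αs t)
          + deriv (fun x => LS (S αs t, x)) (αs t)) := by
  obtain ⟨KT, hKT⟩ := hLTlip
  obtain ⟨KS, hKS⟩ := hLSlip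
  obtain ⟨Kg, hKg⟩ := hglip
  have hSeq : ∀ α : Lp ℝ 2 (timeMeasure T), S α = storage s₀ α := fun α => funext fun t => hS α t
  have hJeq : ∀ α : Lp ℝ 2 (timeMeasure T), J α = totalCost T P Q s₀ LT LS g α := fun α => by
    rw [hJ, hSeq]; rfl
  have hdS : ∀ s x : ℝ, deriv (fun x' => LS (x', x)) s = fderiv ℝ LS (s, x) (1, 0) := fun s x =>
    (HasFDerivAt.comp_hasDerivAt s (hLS.differentiable one_ne_zero (s, x)).hasFDerivAt
      ((hasDerivAt_id s).prodMk (hasDerivAt_const s x))).deriv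
  have hdA : ∀ L : ℝ × ℝ → ℝ, ContDiff ℝ 1 L → ∀ s x : ℝ,
      deriv (fun x' => L (s, x')) x = fderiv ℝ L (s, x) (0, 1) := fun L hL s x =>
    (HasFDerivAt.comp_hasDerivAt x (hL.differentiable one_ne_zero (s, x)).hasFDerivAt
      ((hasDerivAt_const x s).prodMk (hasDerivAt_id x))).deriv
  have hYeq : Y = adjointState T s₀ LS g αs := by
    funext t
    simp only [hY, adjointState, hSeq, hdS]
  have hcond : ∀ t, Y t + P t + deriv (fun x => LT (Q t, x)) (αs t)
      + deriv (fun x => LS (S αs t, x)) (αs t) = costGradient T P Q s₀ LT LS g αs t := fun t => by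
    rw [hdA LT hLT, hdA LS hLS, hYeq, hSeq]; rfl
  simp only [hcond, hJeq]
  set w := costGradient T P Q s₀ LT LS g αs
  have ha : MemLp αs 2 (timeMeasure T) := Lp.memLp αs
  have hw : MemLp w 2 (timeMeasure T) := memLp_costGradient hT hP hQ hLT hLS hKT hKS ha
  constructor
  · intro hmin
    set H : ℝ → ℝ := fun t => ∫ u in (0:ℝ)..t, w u with hH
    have hHm : MemLp H 2 (timeMeasure T) := memLp_primitive hT hw
    have iN : Integrable (fun t => w t ^ 2 + H t ^ 2) (timeMeasure T) :=
      hw.integrable_sq.add hHm.integrable_sq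
    set N : ℝ := (KT + KS) * ∫ t, (w t ^ 2 + H t ^ 2) ∂(timeMeasure T) + Kg * H T ^ 2
    have hexp : ∀ ε : ℝ, 0 ≤ ε * ∫ t, w t ^ 2 ∂(timeMeasure T) + ε ^ 2 * N := by
      intro ε
      have hh : MemLp (fun t => ε * w t) 2 (timeMeasure T) := hw.const_mul ε
      have hβ := hmin (MemLp.toLp _ (ha.add hh))
      rw [totalCost_congr hT P Q s₀ LT LS g (MemLp.coeFn_toLp (ha.add hh))] at hβ
      obtain ⟨iR, hR⟩ := totalCost_add_eq (s₀ := s₀) (g := g) hT hP hQ hLT hLS hKT hKS ha hh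
      have hR1 : ∫ t, runningRemainder Q s₀ LT LS αs (fun t => ε * w t) t ∂(timeMeasure T) ≤
          ∫ t, ε ^ 2 * ((KT + KS) * (w t ^ 2 + H t ^ 2)) ∂(timeMeasure T) := by
        refine integral_mono iR ((iN.const_mul _).const_mul _) fun t => ?_
        refine (runningRemainder_le hLT hLS hKT hKS t).trans_eq ?_
        simp only [hH, intervalIntegral.integral_const_mul]
        ring
      rw [MeasureTheory.integral_const_mul, MeasureTheory.integral_const_mul] at hR1
      have hlin : ∫ t, w t * (ε * w t) ∂(timeMeasure T) = ε * ∫ t, w t ^ 2 ∂(timeMeasure T) := by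
        rw [← MeasureTheory.integral_const_mul]
        congr 1 with t
        ring
      have hgT : g (storage s₀ αs T + ∫ u in (0:ℝ)..T, ε * w u) - g (storage s₀ αs T)
          - deriv g (storage s₀ αs T) * ∫ u in (0:ℝ)..T, ε * w u ≤ ε ^ 2 * (Kg * H T ^ 2) := by
        have hKg' : LipschitzWith Kg (fderiv ℝ g) := by
          refine LipschitzWith.of_dist_le_mul fun x y => ?_
          have : fderiv ℝ g x - fderiv ℝ g y
              = ContinuousLinearMap.toSpanSingleton ℝ (deriv g x - deriv g y) := by
            ext; simp
          rw [dist_eq_norm, this, ContinuousLinearMap.norm_toSpanSingleton]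
          exact hKg.norm_sub_le x y
        have := (le_abs_self _).trans (abs_taylor_remainder_le hg hKg' (storage s₀ αs T)
          (∫ u in (0:ℝ)..T, ε * w u))
        rw [fderiv_eq_smul_deriv, smul_eq_mul, mul_comm (∫ u in (0:ℝ)..T, ε * w u)] at this
        refine this.trans_eq ?_
        rw [intervalIntegral.integral_const_mul, Real.norm_eq_abs, sq_abs]
        simp only [hH]
        ring
      have hβ' : totalCost T P Q s₀ LT LS g αs ≤
          totalCost T P Q s₀ LT LS g (fun t => αs t + ε * w t) := hβ
      rw [hR, hlin] at hβ'
      linarith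
    have hI : 0 ≤ ∫ t, w t ^ 2 ∂(timeMeasure T) := integral_nonneg fun t => sq_nonneg _
    have hzero : ∫ t, w t ^ 2 ∂(timeMeasure T) = 0 := by
      set I := ∫ t, w t ^ 2 ∂(timeMeasure T)
      by_contra hne
      have hpos : 0 < I := lt_of_le_of_ne hI (Ne.symm hne)
      have h1 := hexp (-(I / (|N| + 1 + I)))
      have hd : 0 < |N| + 1 + I := by positivity
      have hεp : 0 < I / (|N| + 1 + I) := div_pos hpos hd
      have hε : I / (|N| + 1 + I) * (|N| + 1 + I) = I := div_mul_cancel₀ _ hd.ne'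
      have hN := le_abs_self N
      set ε := I / (|N| + 1 + I)
      have h3 : ε * N < I := by nlinarith [mul_le_mul_of_nonneg_left hN hεp.le]
      nlinarith [mul_lt_mul_of_pos_left h3 hεp]
    have := (integral_eq_zero_iff_of_nonneg (fun t => sq_nonneg (w t)) hw.integrable_sq).1 hzero
    filter_upwards [this] with t ht
    exact (pow_eq_zero_iff two_ne_zero).1 ht |>.symm
  · intro hzero β
    have hh : MemLp (fun t => β t - αs t) 2 (timeMeasure T) := (Lp.memLp β).sub ha
    obtain ⟨-, hR⟩ := totalCost_add_eq (s₀ := s₀) (g := g) hT hP hQ hLT hLS hKT hKS ha hh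
    have hlin : ∫ t, w t * (β t - αs t) ∂(timeMeasure T) = 0 := by
      apply integral_eq_zero_of_ae
      filter_upwards [hzero] with t ht
      simp only [← ht, zero_mul, Pi.zero_apply]
    have hrem : 0 ≤ ∫ t, runningRemainder Q s₀ LT LS αs (fun t => β t - αs t) t ∂(timeMeasure T) :=
      integral_nonneg fun t => runningRemainder_nonneg hLT hLS (fun q => (hconv q).convexOn) t
    have hgT := hgconv.convexOn.add_fderiv_le
      (hg.differentiable one_ne_zero (storage s₀ αs T)).hasFDerivAt
      (∫ u in (0:ℝ)..T, (β u - αs u))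
    rw [fderiv_eq_smul_deriv, smul_eq_mul, mul_comm] at hgT
    have hsum : (fun t => αs t + (β t - αs t)) = β := by
      funext t
      ring
    rw [hsum, hlin] at hR
    linarith
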